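/- Assume the Irrationality Hypothesis. Then the almost sure theory T^α is not finitely axiomatizable: there is no single L⁺-sentence σ whose models are exactly the models of T^α. -/

import Mathlib

open FirstOrder Filter Topology
open scoped Classical

/-- The finite relational language with relation symbols `R i` of arity `k i`, for `i : Fin p`. -/
def Lang (p : ℕ) (k : Fin p → ℕ) : FirstOrder.Language where
  Functions := fun _ => Empty
  Relations := fun n => { i : Fin p // k i = n }

variable {p : ℕ}

section StructureDefs

/-- The relation `R i` holds on the finite set `C` (set-version of the relation). -/
def HoldsOn (k : Fin p → ℕ) {M : Type*} [(Lang p k).Structure M]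
    (i : Fin p) (C : Finset M) : Prop :=
  ∃ v : Fin (k i) → M, Function.Injective v ∧ Finset.image v Finset.univ = C ∧
    Language.Structure.RelMap (L := Lang p k) (⟨i, rfl⟩ : (Lang p k).Relations (k i)) v

/-- `w i A` : the number of `k i`-element subsets of `A` on which `R i` holds. -/
noncomputable def w (k : Fin p → ℕ) {M : Type*} [(Lang p k).Structure M]
    (i : Fin p) (A : Finset M) : ℕ :=
  Set.ncard {C : Finset M | C ⊆ A ∧ C.card = k i ∧ HoldsOn k i C}

/-- `e(A) = Σ_i α_i · w_i(A)`. -/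
noncomputable def eVal (k : Fin p → ℕ) (α : Fin p → ℝ) {M : Type*} [(Lang p k).Structure M]
    (A : Finset M) : ℝ :=
  ∑ i : Fin p, α i * (w k i A : ℝ)

/-- `δ(A) = |A| − e(A)`. -/
noncomputable def delta (k : Fin p → ℕ) (α : Fin p → ℝ) {M : Type*} [(Lang p k).Structure M]
    (A : Finset M) : ℝ :=
  (A.card : ℝ) - eVal k α A

/-- A structure is symmetric and irreflexive: relations hold only on tuples of pairwise
distinct elements and are invariant under permutations of the tuple. -/
def SymmIrr (k : Fin p → ℕ) (M : Type*) [(Lang p k).Structure M] : Prop :=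
  (∀ (n : ℕ) (r : (Lang p k).Relations n) (v : Fin n → M),
      Language.Structure.RelMap r v → Function.Injective v) ∧
  (∀ (n : ℕ) (r : (Lang p k).Relations n) (v : Fin n → M) (σ : Equiv.Perm (Fin n)),
      Language.Structure.RelMap r v → Language.Structure.RelMap r (v ∘ σ))

/-- Membership in the class `K`: a symmetric irreflexive structure all of whose finite
substructures have (hereditarily) nonnegative `δ`. -/
def InK (k : Fin p → ℕ) (α : Fin p → ℝ) (M : Type*) [(Lang p k).Structure M] : Prop :=
  SymmIrr k M ∧ ∀ A : Finset M, 0 ≤ delta k α A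

/-- A finite structure is in `K_α` if it is symmetric irreflexive and `δ(A) ≥ 0` for every
substructure. -/
def InKalpha (k : Fin p → ℕ) (α : Fin p → ℝ) (B : Type*) [(Lang p k).Structure B] : Prop :=
  SymmIrr k B ∧ ∀ S : Finset B, 0 ≤ delta k α S

/-- `d_B(X) = inf { δ(Y) : X ⊆ Y ⊆ B }` (relative version, inside the finite set `B`). -/
noncomputable def dRel (k : Fin p → ℕ) (α : Fin p → ℝ) {M : Type*} [(Lang p k).Structure M]
    (B X : Finset M) : ℝ :=
  sInf {r : ℝ | ∃ Y : Finset M, X ⊆ Y ∧ Y ⊆ B ∧ r = delta k α Y}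

/-- `A ≤_s B` for finite sets: `A ⊆ B` and `d_A(X) = d_B(X)` for all `X ⊆ A`. -/
def StrongIn (k : Fin p → ℕ) (α : Fin p → ℝ) {M : Type*} [(Lang p k).Structure M]
    (A B : Finset M) : Prop :=
  A ⊆ B ∧ ∀ X : Finset M, X ⊆ A → dRel k α A X = dRel k α B X

/-- `A ≤_i B` (intrinsic extension): there is no `A'` with `A ⊆ A' ⊊ B` and `A' ≤_s B`. -/
def IntrinsicIn (k : Fin p → ℕ) (α : Fin p → ℝ) {M : Type*} [(Lang p k).Structure M]
    (A B : Finset M) : Prop :=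
  A ⊆ B ∧ ∀ A' : Finset M, A ⊆ A' → A' ⊂ B → ¬ StrongIn k α A' B

/-- `cl^m_M(A)`: the union of all `B ⊆ M` with `A ≤_i B` and `|B − A| < m`. -/
def cl (k : Fin p → ℕ) (α : Fin p → ℝ) {M : Type*} [(Lang p k).Structure M]
    (m : ℕ) (A : Finset M) : Set M :=
  {x : M | ∃ B : Finset M, IntrinsicIn k α A B ∧ (B \ A).card < m ∧ x ∈ B}

/-- `C` and `B'` are freely joined over `A` (inside the ambient structure): they intersect in
`A` and every relation on a subset of `C ∪ B'` lives entirely inside `C` or inside `B'`. -/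
def FreelyJoined (k : Fin p → ℕ) {M : Type*} [(Lang p k).Structure M]
    (A C B' : Set M) : Prop :=
  C ∩ B' = A ∧
    ∀ (i : Fin p) (S : Finset M), ↑S ⊆ C ∪ B' → HoldsOn k i S → (↑S ⊆ C ∨ ↑S ⊆ B')

/-- `g` is an embedding (of relational structures). -/
def IsEmb (k : Fin p → ℕ) {M N : Type*} [(Lang p k).Structure M] [(Lang p k).Structure N]
    (g : M → N) : Prop :=
  Function.Injective g ∧
    ∀ (n : ℕ) (r : (Lang p k).Relations n) (v : Fin n → M),
      (Language.Structure.RelMap r (g ∘ v) ↔ Language.Structure.RelMap r v)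

/-- `g` restricted to `A` is an embedding of the substructure on `A`. -/
def IsEmbOn (k : Fin p → ℕ) {M N : Type*} [(Lang p k).Structure M] [(Lang p k).Structure N]
    (A : Finset M) (g : M → N) : Prop :=
  Set.InjOn g ↑A ∧
    ∀ (n : ℕ) (r : (Lang p k).Relations n) (v : Fin n → M), (∀ j, v j ∈ A) →
      (Language.Structure.RelMap r (g ∘ v) ↔ Language.Structure.RelMap r v)

/-- `h` restricts to an isomorphism from the induced structure on `S` onto `S'`. -/
def IsIsoOn (k : Fin p → ℕ) {M N : Type*} [(Lang p k).Structure M] [(Lang p k).Structure N]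
    (S : Set M) (S' : Set N) (h : M → N) : Prop :=
  Set.InjOn h S ∧ h '' S = S' ∧
    ∀ (n : ℕ) (r : (Lang p k).Relations n) (v : Fin n → M), (∀ j, v j ∈ S) →
      (Language.Structure.RelMap r (h ∘ v) ↔ Language.Structure.RelMap r v)

/-- A countable structure `M ∈ K` is `(K_α, ≤_s)`-semigeneric if for every `A ≤_s B` with
`B ∈ K_α` finite and every embedding `g` of `A` into `M`, and each `m`, there is an embedding
`ĝ` of `B` into `M` extending `g` whose image adds nothing to the `m`-closure of `gA` and is
freely joined with `cl^m(gA)` over `gA`. -/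
def Semigeneric (k : Fin p → ℕ) (α : Fin p → ℝ) (M : Type*) [(Lang p k).Structure M] : Prop :=
  Countable M ∧ InK k α M ∧
    ∀ (B : Type) (_ : Fintype B) (_ : (Lang p k).Structure B), InKalpha k α B →
      ∀ A : Finset B, StrongIn k α A Finset.univ →
        ∀ g : B → M, IsEmbOn k A g → ∀ m : ℕ,
          ∃ g' : B → M, IsEmb k g' ∧ (∀ a ∈ A, g' a = g a) ∧
            cl k α m (Finset.image g' Finset.univ) =
              ↑(Finset.image g' Finset.univ) ∪ cl k α m (Finset.image g A) ∧
            FreelyJoined k (↑(Finset.image g A) : Set M) (cl k α m (Finset.image g A))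
              (↑(Finset.image g' Finset.univ))

end StructureDefs

section FormulaDefs

/-- A formula is existential if it is an existential quantifier prefix applied to a
quantifier-free formula. -/
def IsExistential (k : Fin p → ℕ) {r : ℕ} (φ : (Lang p k).Formula (Fin r)) : Prop :=
  ∃ (m : ℕ) (ψ : (Lang p k).BoundedFormula (Fin r) m), ψ.IsQF ∧ φ = ψ.exs

/-- Boolean combinations of existential formulas. -/
inductive IsBoolCombExistential (k : Fin p → ℕ) {r : ℕ} :
    (Lang p k).Formula (Fin r) → Prop
  | of_existential (φ) : IsExistential k φ → IsBoolCombExistential k φ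
  | not (φ) : IsBoolCombExistential k φ → IsBoolCombExistential k φ.not
  | inf (φ ψ) : IsBoolCombExistential k φ → IsBoolCombExistential k ψ →
      IsBoolCombExistential k (φ ⊓ ψ)

end FormulaDefs

section Probability

/-- A configuration of potential relations on `{1,…,n}`: for each relation symbol, a Boolean
choice on each finite subset. -/
abbrev Config (p n : ℕ) := (i : Fin p) → Finset (Fin n) → Bool

/-- The valid configurations: `R i` may only hold on sets of size `k i`. -/
noncomputable def validE (k : Fin p → ℕ) (n : ℕ) : Finset (Config p n) :=
  Finset.univ.filter (fun E => ∀ (i : Fin p) (C : Finset (Fin n)), E i C = true → C.card = k i)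

/-- The probability of the configuration `E`: independently for each `i` and each
`k i`-element set `C`, the relation `R i` holds on `C` with probability `γ i · n^{-α i}`. -/
noncomputable def weight (k : Fin p → ℕ) (α γ : Fin p → ℝ) (n : ℕ) (E : Config p n) : ℝ :=
  ∏ i : Fin p, ∏ C ∈ Finset.univ.filter (fun C : Finset (Fin n) => C.card = k i),
    (if E i C = true then γ i * (n : ℝ) ^ (-(α i)) else 1 - γ i * (n : ℝ) ^ (-(α i)))

/-- The probability `P_n` of an event (a set of configurations). -/
noncomputable def Pev (k : Fin p → ℕ) (α γ : Fin p → ℝ) (n : ℕ)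
    (Q : Config p n → Prop) : ℝ :=
  ∑ E ∈ validE k n, if Q E then weight k α γ n E else 0

/-- The random `L⁺`-structure `G_n` on `Fin n` determined by the configuration `E`. -/
def structOf (k : Fin p → ℕ) (n : ℕ) (E : Config p n) : (Lang p k).Structure (Fin n) where
  funMap := fun {_} f _ => f.elim
  RelMap := fun {_} r v => Function.Injective v ∧ E r.1 (Finset.image v Finset.univ) = true

/-- The probability that `G_n ⊨ φ`. -/
noncomputable def Pn (k : Fin p → ℕ) (α γ : Fin p → ℝ) (n : ℕ)
    (φ : (Lang p k).Sentence) : ℝ :=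
  Pev k α γ n (fun E => letI := structOf k n E; (Fin n) ⊨ φ)

/-- The Irrationality Hypothesis: `α_0, …, α_{p−1}, 1` are linearly independent over `ℚ`. -/
def IrrHyp (α : Fin p → ℝ) : Prop :=
  LinearIndependent ℚ (Fin.snoc α (1 : ℝ) : Fin (p + 1) → ℝ)

/-- The almost sure theory `T^α`: the sentences with limit probability 1. -/
noncomputable def Talpha (k : Fin p → ℕ) (α γ : Fin p → ℝ) : (Lang p k).Theory :=
  {φ : (Lang p k).Sentence | Tendsto (fun n => Pn k α γ n φ) atTop (𝓝 1)}

/-- Auxiliary: `M`, equipped with the structure `S`, satisfies the sentence `φ`. -/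
def RealizeS (k : Fin p → ℕ) (M : Type*) (S : (Lang p k).Structure M)
    (φ : (Lang p k).Sentence) : Prop :=
  letI := S; M ⊨ φ

/-- Auxiliary: `M`, equipped with the structure `S`, is a model of the theory `T`. -/
def ModelsT (k : Fin p → ℕ) (M : Type*) (S : (Lang p k).Structure M)
    (T : (Lang p k).Theory) : Prop :=
  ∀ φ ∈ T, RealizeS k M S φ

end Probability


section WeightLemmas

variable (k : Fin p → ℕ) (α γ : Fin p → ℝ) (n : ℕ)

/-- The weight of a single Boolean choice, putting mass `0` on relations of the wrong arity. -/
noncomputable def cellWeight (i : Fin p) (C : Finset (Fin n)) (b : Bool) : ℝ :=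
  if C.card = k i then
    (if b = true then γ i * (n : ℝ) ^ (-(α i)) else 1 - γ i * (n : ℝ) ^ (-(α i)))
  else (if b = true then 0 else 1)

theorem sum_cellWeight (i : Fin p) (C : Finset (Fin n)) :
    ∑ b : Bool, cellWeight k α γ n i C b = 1 := by
  simp only [Fintype.sum_bool, cellWeight]
  split_ifs <;> simp_all

theorem prod_cellWeight_of_mem {E : Config p n} (hE : E ∈ validE k n) :
    ∏ i, ∏ C, cellWeight k α γ n i C (E i C) = weight k α γ n E := by
  simp only [validE, Finset.mem_filter, Finset.mem_univ, true_and] at hE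
  refine Finset.prod_congr rfl fun i _ => ?_
  rw [Finset.prod_filter]
  refine Finset.prod_congr rfl fun C _ => ?_
  by_cases hC : C.card = k i
  · simp [cellWeight, hC]
  · have : E i C ≠ true := fun h => hC (hE i C h)
    simp [cellWeight, hC, this]

theorem prod_cellWeight_of_notMem {E : Config p n} (hE : E ∉ validE k n) :
    ∏ i, ∏ C, cellWeight k α γ n i C (E i C) = 0 := by
  simp only [validE, Finset.mem_filter, Finset.mem_univ, true_and, not_forall] at hE
  obtain ⟨i, C, h, hC⟩ := hE
  refine Finset.prod_eq_zero (Finset.mem_univ i) (Finset.prod_eq_zero (Finset.mem_univ C) ?_)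
  simp [cellWeight, h, hC]

theorem sum_weight : ∑ E ∈ validE k n, weight k α γ n E = 1 := by
  calc ∑ E ∈ validE k n, weight k α γ n E
      = ∑ E ∈ validE k n, ∏ i, ∏ C, cellWeight k α γ n i C (E i C) :=
        Finset.sum_congr rfl fun E hE => (prod_cellWeight_of_mem k α γ n hE).symm
    _ = ∑ E : Config p n, ∏ i, ∏ C, cellWeight k α γ n i C (E i C) :=
        Finset.sum_subset (Finset.subset_univ _) fun E _ hE =>
          prod_cellWeight_of_notMem k α γ n hE
    _ = ∏ i : Fin p, ∑ e : Finset (Fin n) → Bool, ∏ C, cellWeight k α γ n i C (e C) :=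
        (Fintype.prod_sum fun i (e : Finset (Fin n) → Bool) =>
          ∏ C, cellWeight k α γ n i C (e C)).symm
    _ = ∏ i : Fin p, ∏ C : Finset (Fin n), ∑ b : Bool, cellWeight k α γ n i C b :=
        Finset.prod_congr rfl fun i _ => (Fintype.prod_sum _).symm
    _ = 1 := by simp only [sum_cellWeight, Finset.prod_const_one]

variable {k α γ n}

theorem weight_nonneg (hα : ∀ i, 0 < α i ∧ α i ≤ 1) (hγ : ∀ i, 0 < γ i ∧ γ i ≤ 1)
    (hn : 1 ≤ n) (E : Config p n) : 0 ≤ weight k α γ n E := by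
  refine Finset.prod_nonneg fun i _ => Finset.prod_nonneg fun C _ => ?_
  have h0 : 0 ≤ (n : ℝ) ^ (-(α i)) := by positivity
  have h1 : (n : ℝ) ^ (-(α i)) ≤ 1 :=
    Real.rpow_le_one_of_one_le_of_nonpos (by exact_mod_cast hn) (by linarith [(hα i).1])
  split_ifs
  · exact mul_nonneg (hγ i).1.le h0
  · linarith [mul_le_one₀ (hγ i).2 h0 h1]

theorem Pev_eq_one {Q : Config p n → Prop} (hQ : ∀ E, Q E) : Pev k α γ n Q = 1 := by
  simp only [Pev, hQ, if_true, sum_weight]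

/-- If the failure probabilities of finitely many events sum to less than `1`, the events
occur simultaneously for some configuration. -/
theorem exists_forall_of_sum_lt_one (hα : ∀ i, 0 < α i ∧ α i ≤ 1)
    (hγ : ∀ i, 0 < γ i ∧ γ i ≤ 1) (hn : 1 ≤ n) {ι : Type*} (s : Finset ι)
    (Q : ι → Config p n → Prop) (hs : ∑ x ∈ s, (1 - Pev k α γ n (Q x)) < 1) :
    ∃ E, ∀ x ∈ s, Q x E := by
  by_contra! h
  refine hs.not_ge ?_
  have hfail : ∀ x, 1 - Pev k α γ n (Q x) =
      ∑ E ∈ validE k n, if Q x E then 0 else weight k α γ n E := fun x => by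
    rw [← sum_weight k α γ n, Pev, ← Finset.sum_sub_distrib]
    refine Finset.sum_congr rfl fun E _ => ?_
    split_ifs <;> simp
  simp only [hfail]
  rw [Finset.sum_comm, ← sum_weight k α γ n]
  refine Finset.sum_le_sum fun E _ => ?_
  obtain ⟨x, hx, hxE⟩ := h E
  calc weight k α γ n E = if Q x E then 0 else weight k α γ n E := by rw [if_neg hxE]
    _ ≤ _ := Finset.single_le_sum (f := fun x => if Q x E then 0 else weight k α γ n E)
        (fun y _ => by split_ifs; exacts [le_rfl, weight_nonneg hα hγ hn E]) hx

end WeightLemmas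

section AlmostSureTheory

variable {k : Fin p → ℕ} {α γ : Fin p → ℝ}

/-- Every finite part of the almost sure theory has a finite nonempty model. -/
theorem exists_finite_model (hα : ∀ i, 0 < α i ∧ α i ≤ 1) (hγ : ∀ i, 0 < γ i ∧ γ i ≤ 1)
    (T₀ : Finset (Lang p k).Sentence) (hT₀ : (T₀ : (Lang p k).Theory) ⊆ Talpha k α γ) :
    ∃ n : ℕ, 1 ≤ n ∧ ∃ S : (Lang p k).Structure (Fin n), ModelsT k (Fin n) S T₀ := by
  have hlim : Tendsto (fun n => ∑ φ ∈ T₀, (1 - Pn k α γ n φ)) atTop (𝓝 0) := by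
    have : Tendsto (fun n => ∑ φ ∈ T₀, (1 - Pn k α γ n φ)) atTop
        (𝓝 (∑ φ ∈ T₀, (1 - 1 : ℝ))) :=
      tendsto_finsetSum _ fun φ hφ => tendsto_const_nhds.sub (hT₀ hφ)
    simpa using this
  obtain ⟨n, hlt, hn⟩ :=
    ((hlim.eventually_lt_const one_pos).and (eventually_ge_atTop 1)).exists
  obtain ⟨E, hE⟩ := exists_forall_of_sum_lt_one hα hγ hn T₀
    (fun φ E => RealizeS k (Fin n) (structOf k n E) φ) hlt
  exact ⟨n, hn, structOf k n E, hE⟩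

/-- The almost sure theory says that the universe has at least `m` elements. -/
theorem cardGe_mem_Talpha (m : ℕ) :
    Language.Sentence.cardGe (Lang p k) m ∈ Talpha k α γ := by
  refine tendsto_const_nhds.congr' ?_
  filter_upwards [eventually_ge_atTop m] with n hn
  refine (Pev_eq_one fun E => ?_).symm
  let := structOf k n E
  rw [Language.Sentence.realize_cardGe]
  simpa using hn

theorem not_modelsT_Talpha_fin (n : ℕ) (S : (Lang p k).Structure (Fin n)) :
    ¬ ModelsT k (Fin n) S (Talpha k α γ) := by
  intro h
  have hc := h _ (cardGe_mem_Talpha (n + 1))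
  let := S
  rw [RealizeS, Language.Sentence.realize_cardGe] at hc
  have : n + 1 ≤ n := by simpa only [Cardinal.mk_fin, Nat.cast_le] using hc
  omega

end AlmostSureTheory

-- STATEMENT 5
theorem Talpha_not_finitely_axiomatizable (k : Fin p → ℕ) (α γ : Fin p → ℝ)
    (hα : ∀ i, 0 < α i ∧ α i ≤ 1) (hγ : ∀ i, 0 < γ i ∧ γ i ≤ 1)
    (hirr : IrrHyp α) :
    ¬ ∃ σ : (Lang p k).Sentence, ∀ (M : Type) (S : (Lang p k).Structure M), Nonempty M →
        (RealizeS k M S σ ↔ ModelsT k M S (Talpha k α γ)) := by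
  rintro ⟨σ, hσ⟩
  have hmodels : Talpha k α γ ⊨ᵇ σ := by
    rw [Language.Theory.models_sentence_iff]
    intro M
    exact (hσ M _ M.nonempty').2 fun φ hφ => M.is_model.realize_of_mem φ hφ
  obtain ⟨T₀, hT₀, hT₀σ⟩ := Language.Theory.models_iff_finset_models.1 hmodels
  obtain ⟨n, hn, S, hS⟩ := exists_finite_model hα hγ T₀ hT₀
  have : Nonempty (Fin n) := ⟨⟨0, hn⟩⟩
  refine not_modelsT_Talpha_fin n S ((hσ (Fin n) S ‹_›).1 ?_)
  let := S
  have : Fin n ⊨ (T₀ : (Lang p k).Theory) := ⟨hS⟩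
  exact hT₀σ.realize_sentence (Fin n)
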